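/- Let M be an m×n complex matrix, let I be a set of k row indices and J a set of l column indices, and set C = M(:,J) ∈ ℂ^{m×l} (the submatrix of the columns of M indexed by J), R = M(I,:) ∈ ℂ^{k×n} (the submatrix of the rows of M indexed by I), and G = M(I,J) ∈ ℂ^{k×l} (their common submatrix). Let G⁺ denote the Moore–Penrose pseudoinverse of G, i.e., the unique l×k matrix X satisfying GXG = G, XGX = X, (GX)ᴴ = GX, and (XG)ᴴ = XG. If rank(M) = ρ > 0, then M = C·G⁺·R if and only if rank(G) = rank(M) = ρ. -/

import Mathlib

open Matrix

theorem cur_aux_factor {m n l : ℕ} (M : Matrix (Fin m) (Fin n) ℂ) (Q : Matrix (Fin n) (Fin l) ℂ)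
    (h : M.rank ≤ (M * Q).rank) : ∃ A : Matrix (Fin l) (Fin n) ℂ, M = M * Q * A := by
  have hle : LinearMap.range (M * Q).mulVecLin ≤ LinearMap.range M.mulVecLin := by
    rintro _ ⟨v, rfl⟩
    exact ⟨Q *ᵥ v, by simp [Matrix.mulVec_mulVec]⟩
  have heq := Submodule.eq_of_le_of_finrank_le hle h
  have hcol : ∀ j : Fin n, ∃ a : Fin l → ℂ, (M * Q) *ᵥ a = M *ᵥ Pi.single j 1 := by
    intro j
    have : M *ᵥ Pi.single j 1 ∈ LinearMap.range (M * Q).mulVecLin := by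
      rw [heq]
      exact ⟨Pi.single j 1, rfl⟩
    obtain ⟨a, ha⟩ := this
    exact ⟨a, ha⟩
  choose a ha using hcol
  refine ⟨Matrix.of fun i j => a j i, ?_⟩
  ext i j
  have := congrFun (ha j) i
  rw [Matrix.mulVec_single_one] at this
  exact this.symm

theorem cur_aux_factor_left {m n k : ℕ} (M : Matrix (Fin m) (Fin n) ℂ)
    (P : Matrix (Fin k) (Fin m) ℂ)
    (h : M.rank ≤ (P * M).rank) : ∃ B : Matrix (Fin m) (Fin k) ℂ, M = B * (P * M) := by
  obtain ⟨A, hA⟩ := cur_aux_factor Mᵀ Pᵀ (by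
    rw [← Matrix.transpose_mul, Matrix.rank_transpose, Matrix.rank_transpose]
    exact h)
  refine ⟨Aᵀ, ?_⟩
  have := congrArg Matrix.transpose hA
  simpa [Matrix.transpose_mul] using this

/-- **Canonical CUR decomposition via the Moore–Penrose pseudoinverse.**  Let `M` be an
`m×n` complex matrix, let `C`, `R`, `G` be the submatrices of `M` given by a set of `l`
columns, a set of `k` rows, and their common entries, respectively, and let `X` be the
Moore–Penrose pseudoinverse of `G` (characterized by the four Penrose equations).  If
`rank M = ρ > 0`, then `M = C * X * R` if and only if `rank G = rank M = ρ`. -/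
theorem cur_decomposition_iff_rank_eq {m n k l ρ : ℕ}
    (M : Matrix (Fin m) (Fin n) ℂ)
    (rowIdx : Fin k → Fin m) (colIdx : Fin l → Fin n)
    (hrow : Function.Injective rowIdx) (hcol : Function.Injective colIdx)
    (C : Matrix (Fin m) (Fin l) ℂ) (hC : C = M.submatrix id colIdx)
    (R : Matrix (Fin k) (Fin n) ℂ) (hR : R = M.submatrix rowIdx id)
    (G : Matrix (Fin k) (Fin l) ℂ) (hG : G = M.submatrix rowIdx colIdx)
    (X : Matrix (Fin l) (Fin k) ℂ)
    (hX1 : G * X * G = G) (hX2 : X * G * X = X)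
    (hX3 : (G * X)ᴴ = G * X) (hX4 : (X * G)ᴴ = X * G)
    (hrank : M.rank = ρ) (hρ : 0 < ρ) :
    M = C * X * R ↔ (G.rank = M.rank ∧ M.rank = ρ) := by
  obtain ⟨Q, hQ⟩ : ∃ Q : Matrix (Fin n) (Fin l) ℂ, C = M * Q :=
    ⟨(1 : Matrix (Fin n) (Fin n) ℂ).submatrix id colIdx, by
      rw [hC]; ext i j; simp [Matrix.mul_apply, Matrix.one_apply]⟩
  obtain ⟨P, hP, hPG⟩ : ∃ P : Matrix (Fin k) (Fin m) ℂ, R = P * M ∧ G = P * C :=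
    ⟨(1 : Matrix (Fin m) (Fin m) ℂ).submatrix rowIdx id, by
      rw [hR]; ext i j; simp [Matrix.mul_apply, Matrix.one_apply], by
      rw [hG, hC]; ext i j; simp [Matrix.mul_apply, Matrix.one_apply]⟩
  have hRQ : G = R * Q := by rw [hPG, hP, hQ, Matrix.mul_assoc]
  have hGC : G.rank ≤ C.rank := by rw [hPG]; exact Matrix.rank_mul_le_right _ _
  have hGR : G.rank ≤ R.rank := by rw [hRQ]; exact Matrix.rank_mul_le_left _ _
  have hCM : C.rank ≤ M.rank := by rw [hQ]; exact Matrix.rank_mul_le_left _ _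
  constructor
  · intro h
    refine ⟨le_antisymm (hGC.trans hCM) ?_, hrank⟩
    calc M.rank = (C * X * R).rank := by rw [← h]
      _ ≤ (C * X).rank := Matrix.rank_mul_le_left _ _
      _ ≤ X.rank := Matrix.rank_mul_le_right _ _
      _ = (X * G * X).rank := by rw [hX2]
      _ ≤ (X * G).rank := Matrix.rank_mul_le_left _ _
      _ ≤ G.rank := Matrix.rank_mul_le_right _ _
  · rintro ⟨h, -⟩
    obtain ⟨A, hA⟩ := cur_aux_factor M Q (by rw [← hQ, ← h]; exact hGC)
    obtain ⟨B, hB⟩ := cur_aux_factor_left M P (by rw [← hP, ← h]; exact hGR)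
    rw [← hQ] at hA
    rw [← hP] at hB
    have hRA : R = G * A := by rw [hPG, Matrix.mul_assoc, ← hA, hP]
    have hCB : C = B * G := by rw [hRQ, ← Matrix.mul_assoc, ← hB, hQ]
    calc M = C * A := hA
      _ = B * (G * X * G) * A := by rw [hX1, ← hCB]
      _ = (B * G) * X * (G * A) := by simp only [Matrix.mul_assoc]
      _ = C * X * R := by rw [← hCB, ← hRA]
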